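/- If G is a minimal counterexample and {e_1, e_2} is an edge-cut of G of size two (i.e., e_1 ≠ e_2 and deleting both e_1 and e_2 disconnects G), then e_1 and e_2 share a common endpoint that has degree 2 in G. -/

import Mathlib

open SimpleGraph

/-- A `(1,2^k)`-packing edge-coloring encoded as a function assigning a color in
`Fin (k+1)` to each unordered pair. Color `0` is the 1-color (its class must be a
matching) and each color `i ≠ 0` is a 2-color (its class must be an induced matching). -/
def IsPackingEC {V : Type} (G : SimpleGraph V) (k : ℕ)
    (c : Sym2 V → Fin (k + 1)) : Prop :=
  (∀ a b x y : V, G.Adj a b → G.Adj x y → s(a, b) ≠ s(x, y) →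
      c s(a, b) = 0 → c s(x, y) = 0 →
      a ≠ x ∧ a ≠ y ∧ b ≠ x ∧ b ≠ y) ∧
  ∀ a b x y : V, G.Adj a b → G.Adj x y → s(a, b) ≠ s(x, y) →
      c s(a, b) = c s(x, y) → c s(a, b) ≠ 0 →
      (a ≠ x ∧ a ≠ y ∧ b ≠ x ∧ b ≠ y) ∧
      ¬G.Adj a x ∧ ¬G.Adj a y ∧ ¬G.Adj b x ∧ ¬G.Adj b y

/-- A good coloring: a `(1,2^7)`-packing edge-coloring in which every edge of the
1-color class (color `0`) has both endpoints of degree 3. -/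
def GoodColoring {V : Type} (G : SimpleGraph V) (c : Sym2 V → Fin 8) : Prop :=
  IsPackingEC G 7 c ∧
  ∀ a b : V, G.Adj a b → c s(a, b) = 0 →
    (G.neighborSet a).ncard = 3 ∧ (G.neighborSet b).ncard = 3

/-- A graph is subcubic if every vertex has degree at most 3. -/
def Subcubic {V : Type} (G : SimpleGraph V) : Prop :=
  ∀ v : V, (G.neighborSet v).ncard ≤ 3

/-- A minimal counterexample: a finite subcubic simple graph with no good coloring such
that every finite subcubic simple graph with smaller `|V| + |E|` has a good coloring. -/
def MinCounter (V : Type) [Finite V] (G : SimpleGraph V) : Prop :=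
  Subcubic G ∧
  (¬∃ c : Sym2 V → Fin 8, GoodColoring G c) ∧
  ∀ (W : Type) [Finite W] (H : SimpleGraph W), Subcubic H →
    Nat.card W + H.edgeSet.ncard < Nat.card V + G.edgeSet.ncard →
    ∃ c : Sym2 W → Fin 8, GoodColoring H c

theorem GoodColoring.ne {V : Type} {G : SimpleGraph V} {c : Sym2 V → Fin 8}
    (hc : GoodColoring G c) {a b d : V} (hab : G.Adj a b) (hbd : G.Adj b d) (had : a ≠ d) :
    c s(a, b) ≠ c s(b, d) := by
  intro h
  have hs : s(a, b) ≠ s(b, d) := by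
    intro h'
    rcases Sym2.eq_iff.1 h' with ⟨rfl, rfl⟩ | ⟨rfl, -⟩
    · exact hab.ne rfl
    · exact had rfl
  by_cases h0 : c s(a, b) = 0
  · exact (hc.1.1 a b b d hab hbd hs h0 (h ▸ h0)).2.2.1 rfl
  · exact (hc.1.2 a b b d hab hbd hs h h0).1.2.2.1 rfl

theorem GoodColoring.eq_zero {V : Type} {G : SimpleGraph V} {c : Sym2 V → Fin 8}
    (hc : GoodColoring G c) {a b d e : V} (hab : G.Adj a b) (hbd : G.Adj b d)
    (hde : G.Adj d e) (had : a ≠ d) (h : c s(a, b) = c s(d, e)) :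
    c s(a, b) = 0 := by
  have hs : s(a, b) ≠ s(d, e) := by
    intro h'
    rcases Sym2.eq_iff.1 h' with ⟨rfl, -⟩ | ⟨-, rfl⟩
    · exact had rfl
    · exact hbd.ne rfl
  by_contra h0
  exact (hc.1.2 a b d e hab hde hs h h0).2.2.2.1 hbd

/-- A good coloring may be checked on paths with two and three edges. -/
theorem GoodColoring.of_paths {V : Type} {G : SimpleGraph V} {c : Sym2 V → Fin 8}
    (h₁ : ∀ a b d, G.Adj a b → G.Adj b d → a ≠ d → c s(a, b) ≠ c s(b, d))
    (h₂ : ∀ a b d e, G.Adj a b → G.Adj b d → G.Adj d e → a ≠ d → b ≠ e →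
      c s(a, b) = c s(d, e) → c s(a, b) = 0)
    (h₃ : ∀ a b, G.Adj a b → c s(a, b) = 0 → (G.neighborSet a).ncard = 3) :
    GoodColoring G c := by
  have share : ∀ a b x y, G.Adj a b → G.Adj x y → s(a, b) ≠ s(x, y) →
      c s(a, b) = c s(x, y) → a ≠ x ∧ a ≠ y ∧ b ≠ x ∧ b ≠ y := by
    intro a b x y hab hxy hs h
    refine ⟨?_, ?_, ?_, ?_⟩ <;> rintro rfl
    · refine h₁ b a y hab.symm hxy ?_ (by rwa [Sym2.eq_swap])
      rintro rfl; exact hs rfl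
    · refine h₁ b a x hab.symm hxy.symm ?_ (by rw [Sym2.eq_swap, h, Sym2.eq_swap])
      rintro rfl; exact hs Sym2.eq_swap
    · refine h₁ a b y hab hxy ?_ h
      rintro rfl; exact hs Sym2.eq_swap
    · refine h₁ a b x hab hxy.symm ?_ (by rwa [Sym2.eq_swap (a := b)])
      rintro rfl; exact hs rfl
  refine ⟨⟨fun a b x y hab hxy hs h h' ↦ share a b x y hab hxy hs (h.trans h'.symm), ?_⟩, ?_⟩
  · intro a b x y hab hxy hs h h0
    obtain ⟨n1, n2, n3, n4⟩ := share a b x y hab hxy hs h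
    refine ⟨⟨n1, n2, n3, n4⟩, ?_, ?_, ?_, ?_⟩ <;> intro hadj <;> apply h0
    · rw [Sym2.eq_swap] at h ⊢
      exact h₂ b a x y hab.symm hadj hxy n3 n2 h
    · rw [Sym2.eq_swap, Sym2.eq_swap (a := x)] at h
      rw [Sym2.eq_swap]
      exact h₂ b a y x hab.symm hadj hxy.symm n4 n1 h
    · exact h₂ a b x y hab hadj hxy n1 n4 h
    · rw [Sym2.eq_swap (a := x)] at h
      exact h₂ a b y x hab hadj hxy.symm n2 n3 h
  · intro a b hab h
    exact ⟨h₃ a b hab h, h₃ b a hab.symm (by rwa [Sym2.eq_swap])⟩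

open Classical in
/-- The colors of the edges at `u`. -/
noncomputable def nearColors {V : Type} (G : SimpleGraph V) (c : Sym2 V → Fin 8) (u : V) :
    Finset (Fin 8) :=
  {k | ∃ x, G.Adj u x ∧ c s(u, x) = k}

open Classical in
/-- The colors of the edges at neighbors of `u`. -/
noncomputable def farColors {V : Type} (G : SimpleGraph V) (c : Sym2 V → Fin 8) (u : V) :
    Finset (Fin 8) :=
  {k | ∃ x z, G.Adj u x ∧ G.Adj x z ∧ c s(x, z) = k}

section Colors

variable {V : Type} {G : SimpleGraph V} {c : Sym2 V → Fin 8} {u : V} {k : Fin 8}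

theorem mem_nearColors : k ∈ nearColors G c u ↔ ∃ x, G.Adj u x ∧ c s(u, x) = k := by
  simp [nearColors]

theorem mem_farColors :
    k ∈ farColors G c u ↔ ∃ x z, G.Adj u x ∧ G.Adj x z ∧ c s(x, z) = k := by
  simp [farColors]

theorem nearColors_subset_farColors : nearColors G c u ⊆ farColors G c u := by
  intro k hk
  obtain ⟨x, hx, rfl⟩ := mem_nearColors.1 hk
  exact mem_farColors.2 ⟨x, u, hx, hx.symm, by rw [Sym2.eq_swap]⟩

theorem card_nearColors_le [Finite V] : (nearColors G c u).card ≤ (G.neighborSet u).ncard := by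
  have h : (nearColors G c u : Set (Fin 8)) = (fun x ↦ c s(u, x)) '' G.neighborSet u := by
    ext k; simp [mem_nearColors]
  rw [← Set.ncard_coe_finset, h]
  exact Set.ncard_image_le

theorem card_farColors_le [Finite V] (hG : Subcubic G) :
    (farColors G c u).card ≤ (G.neighborSet u).ncard * 3 := by
  classical
  have hfin := Set.toFinite (G.neighborSet u)
  have h : farColors G c u ⊆ hfin.toFinset.biUnion (fun x ↦ nearColors G c x) := by
    intro k hk
    obtain ⟨x, z, hx, hz, rfl⟩ := mem_farColors.1 hk
    simp only [Finset.mem_biUnion, Set.Finite.mem_toFinset, mem_neighborSet]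
    exact ⟨x, hx, mem_nearColors.2 ⟨z, hz, rfl⟩⟩
  rw [Set.ncard_eq_toFinset_card _ hfin]
  exact (Finset.card_le_card h).trans
    (Finset.card_biUnion_le_card_mul _ _ _ fun x _ ↦ card_nearColors_le.trans (hG x))

theorem GoodColoring.zero_notMem_nearColors (hc : GoodColoring G c)
    (hu : (G.neighborSet u).ncard ≤ 2) : 0 ∉ nearColors G c u := by
  intro h
  obtain ⟨x, hx, h0⟩ := mem_nearColors.1 h
  have := (hc.2 u x hx h0).1
  omega

end Colors

theorem ncard_neighborSet_mono {V : Type} [Finite V] {G H : SimpleGraph V} (h : H ≤ G) (u : V) :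
    (H.neighborSet u).ncard ≤ (G.neighborSet u).ncard :=
  Set.ncard_le_ncard fun _ hx ↦ h hx

theorem Subcubic.mono {V : Type} [Finite V] {G H : SimpleGraph V} (hG : Subcubic G) (h : H ≤ G) :
    Subcubic H :=
  fun v ↦ (ncard_neighborSet_mono h v).trans (hG v)

theorem ncard_neighborSet_deleteEdges_lt {V : Type} [Finite V] {G : SimpleGraph V} {u v : V}
    {s : Set (Sym2 V)} (huv : G.Adj u v) (hs : s(u, v) ∈ s) :
    ((G.deleteEdges s).neighborSet u).ncard < (G.neighborSet u).ncard := by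
  refine Set.ncard_lt_ncard ⟨fun x hx ↦ G.deleteEdges_le s hx, fun h ↦ ?_⟩
  have h' : (G.deleteEdges s).Adj u v := h huv
  exact (G.deleteEdges_adj.1 h').2 hs

/-- Color `k` may be given to the edge `uv` as far as edges beyond `u` and `v` are concerned,
when these edges show the colors in `S` at `u` and in `T` at `v`. -/
def AdmissibleColor {V : Type} (G : SimpleGraph V) (u v : V) (S T : Finset (Fin 8))
    (k : Fin 8) : Prop :=
  (k ≠ 0 ∧ k ∉ S ∧ k ∉ T) ∨ (k = 0 ∧ (G.neighborSet u).ncard = 3 ∧ (G.neighborSet v).ncard = 3)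

open Classical in
theorem GoodColoring.add_edge {V : Type} [Finite V] {G : SimpleGraph V} {c : Sym2 V → Fin 8}
    {u v : V} (hG : Subcubic G) (huv : G.Adj u v)
    (hc : GoodColoring (G.deleteEdges {s(u, v)}) c) {k : Fin 8}
    (hd : Disjoint (nearColors (G.deleteEdges {s(u, v)}) c u)
      (nearColors (G.deleteEdges {s(u, v)}) c v))
    (hk : AdmissibleColor G u v (farColors (G.deleteEdges {s(u, v)}) c u)
      (farColors (G.deleteEdges {s(u, v)}) c v) k) :
    GoodColoring G (Function.update c s(u, v) k) := by
  set H := G.deleteEdges {s(u, v)} with hH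
  have hadj : ∀ {x y}, G.Adj x y → s(x, y) ≠ s(u, v) → H.Adj x y := by
    intro x y h h'
    rw [hH, deleteEdges_adj]; exact ⟨h, h'⟩
  have key : ∀ x y, s(x, y) = s(u, v) → Disjoint (nearColors H c x) (nearColors H c y) ∧
      k ∉ nearColors H c x ∧ k ∉ nearColors H c y ∧ (k ≠ 0 → k ∉ farColors H c x) ∧
      (k ≠ 0 → k ∉ farColors H c y) ∧ (k = 0 → (G.neighborSet x).ncard = 3) := by
    have hu : (H.neighborSet u).ncard < (G.neighborSet u).ncard :=
      ncard_neighborSet_deleteEdges_lt huv rfl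
    have hv : (H.neighborSet v).ncard < (G.neighborSet v).ncard :=
      ncard_neighborSet_deleteEdges_lt huv.symm Sym2.eq_swap
    have hu3 := hG u
    have hv3 := hG v
    have h0u := hc.zero_notMem_nearColors (u := u) (by omega)
    have h0v := hc.zero_notMem_nearColors (u := v) (by omega)
    have su := nearColors_subset_farColors (G := H) (c := c) (u := u)
    have sv := nearColors_subset_farColors (G := H) (c := c) (u := v)
    intro x y hxy
    rcases hk with ⟨h0, hku, hkv⟩ | ⟨rfl, hku, hkv⟩ <;>
      rcases Sym2.eq_iff.1 hxy with ⟨rfl, rfl⟩ | ⟨rfl, rfl⟩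
    · exact ⟨hd, fun h ↦ hku (su h), fun h ↦ hkv (sv h), fun _ ↦ hku, fun _ ↦ hkv,
        fun h ↦ absurd h h0⟩
    · exact ⟨hd.symm, fun h ↦ hkv (sv h), fun h ↦ hku (su h), fun _ ↦ hkv, fun _ ↦ hku,
        fun h ↦ absurd h h0⟩
    · exact ⟨hd, h0u, h0v, fun h ↦ absurd rfl h, fun h ↦ absurd rfl h, fun _ ↦ hku⟩
    · exact ⟨hd.symm, h0v, h0u, fun h ↦ absurd rfl h, fun h ↦ absurd rfl h, fun _ ↦ hkv⟩
  apply GoodColoring.of_paths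
  · intro a b d hab hbd had
    by_cases h1 : s(a, b) = s(u, v)
    · have h2 : s(b, d) ≠ s(u, v) := by
        intro h2
        rw [← h1, Sym2.eq_swap, Sym2.congr_left] at h2
        exact had h2.symm
      rw [h1, Function.update_self, Function.update_of_ne h2]
      intro h
      exact (key a b h1).2.2.1 (mem_nearColors.2 ⟨d, hadj hbd h2, h.symm⟩)
    · rw [Function.update_of_ne h1]
      by_cases h2 : s(b, d) = s(u, v)
      · rw [h2, Function.update_self]
        intro h
        exact (key b d h2).2.1
          (mem_nearColors.2 ⟨a, (hadj hab h1).symm, by rw [Sym2.eq_swap]; exact h⟩)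
      · rw [Function.update_of_ne h2]
        exact hc.ne (hadj hab h1) (hadj hbd h2) had
  · intro a b d e hab hbd hde had hbe
    by_cases h1 : s(a, b) = s(u, v)
    · have h2 : s(b, d) ≠ s(u, v) := by
        intro h2
        rw [← h1, Sym2.eq_swap, Sym2.congr_left] at h2
        exact had h2.symm
      have h3 : s(d, e) ≠ s(u, v) := by
        intro h3
        rcases Sym2.eq_iff.1 (h1.trans h3.symm) with ⟨h, -⟩ | ⟨-, h⟩
        · exact had h
        · exact hbd.ne h
      rw [h1, Function.update_self, Function.update_of_ne h3]
      intro h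
      by_contra h0
      exact (key a b h1).2.2.2.2.1 h0 (mem_farColors.2 ⟨d, e, hadj hbd h2, hadj hde h3, h.symm⟩)
    · rw [Function.update_of_ne h1]
      by_cases h3 : s(d, e) = s(u, v)
      · have h2 : s(b, d) ≠ s(u, v) := by
          intro h2
          rw [← h3, Sym2.eq_swap, Sym2.congr_right] at h2
          exact hbe h2
        rw [h3, Function.update_self]
        intro h
        rw [h]
        by_contra h0
        exact (key d e h3).2.2.2.1 h0 (mem_farColors.2
          ⟨b, a, (hadj hbd h2).symm, (hadj hab h1).symm, by rw [Sym2.eq_swap]; exact h⟩)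
      · rw [Function.update_of_ne h3]
        by_cases h2 : s(b, d) = s(u, v)
        · intro h
          exact absurd (mem_nearColors.2 ⟨e, hadj hde h3, rfl⟩)
            (Finset.disjoint_left.1 (key b d h2).1
              (mem_nearColors.2 ⟨a, (hadj hab h1).symm, by rw [Sym2.eq_swap]; exact h⟩))
        · exact hc.eq_zero (hadj hab h1) (hadj hbd h2) (hadj hde h3) had
  · intro a b hab
    by_cases h1 : s(a, b) = s(u, v)
    · rw [h1, Function.update_self]
      exact (key a b h1).2.2.2.2.2
    · rw [Function.update_of_ne h1]
      intro h
      have h3 := (hc.2 a b (hadj hab h1) h).1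
      have := ncard_neighborSet_mono (H := H) (G.deleteEdges_le {s(u, v)}) a
      have := hG a
      omega

open Classical in
theorem GoodColoring.add_two_edges {V : Type} [Finite V] {G : SimpleGraph V}
    {c : Sym2 V → Fin 8} {u₁ v₁ u₂ v₂ : V} (hG : Subcubic G)
    (h₁ : G.Adj u₁ v₁) (h₂ : G.Adj u₂ v₂)
    (huu : u₁ ≠ u₂) (huv : u₁ ≠ v₂) (hvu : v₁ ≠ u₂) (hvv : v₁ ≠ v₂)
    {H : SimpleGraph V} (hH : H = G.deleteEdges {s(u₁, v₁), s(u₂, v₂)})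
    (hc : GoodColoring H c) {k₁ k₂ : Fin 8} (hk : k₁ = k₂ → k₁ = 0)
    (hd₁ : Disjoint (nearColors H c u₁) (nearColors H c v₁))
    (hd₂ : Disjoint (nearColors H c u₂) (nearColors H c v₂))
    (hk₁ : AdmissibleColor G u₁ v₁ (farColors H c u₁) (farColors H c v₁) k₁)
    (hk₂ : AdmissibleColor G u₂ v₂ (farColors H c u₂) (farColors H c v₂) k₂) :
    ∃ c', GoodColoring G c' := by
  set G₁ := G.deleteEdges {s(u₂, v₂)} with hG₁
  have hH₁ : H = G₁.deleteEdges {s(u₁, v₁)} := by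
    rw [hH, hG₁, deleteEdges_deleteEdges, Set.union_comm]; rfl
  have hadj : ∀ {x y}, G₁.Adj x y → s(x, y) ≠ s(u₁, v₁) → H.Adj x y := by
    intro x y h h'
    rw [hH₁, deleteEdges_adj]; exact ⟨h, h'⟩
  have hne : s(u₁, v₁) ≠ s(u₂, v₂) := by
    intro h
    rcases Sym2.eq_iff.1 h with ⟨h, -⟩ | ⟨h, -⟩
    · exact huu h
    · exact huv h
  have hG₁3 : Subcubic G₁ := hG.mono (G.deleteEdges_le _)
  have nbr : ∀ x, x ≠ u₂ → x ≠ v₂ → G₁.neighborSet x = G.neighborSet x := by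
    intro x hx hx'
    ext y
    simp only [mem_neighborSet, hG₁, deleteEdges_adj, Set.mem_singleton_iff, and_iff_left_iff_imp]
    intro _ h
    rcases Sym2.eq_iff.1 h with ⟨h, -⟩ | ⟨h, -⟩
    · exact hx h
    · exact hx' h
  have near : ∀ x, x ≠ u₁ → x ≠ v₁ →
      nearColors G₁ (Function.update c s(u₁, v₁) k₁) x ⊆ nearColors H c x := by
    intro x hx hx' k hk
    obtain ⟨y, hy, rfl⟩ := mem_nearColors.1 hk
    have : s(x, y) ≠ s(u₁, v₁) := by
      intro h
      rcases Sym2.eq_iff.1 h with ⟨h, -⟩ | ⟨h, -⟩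
      · exact hx h
      · exact hx' h
    exact mem_nearColors.2 ⟨y, hadj hy this, by rw [Function.update_of_ne this]⟩
  have far : ∀ x, x ≠ u₁ → x ≠ v₁ →
      farColors G₁ (Function.update c s(u₁, v₁) k₁) x ⊆ insert k₁ (farColors H c x) := by
    intro x hx hx' k hk
    obtain ⟨y, z, hy, hz, rfl⟩ := mem_farColors.1 hk
    have : s(x, y) ≠ s(u₁, v₁) := by
      intro h
      rcases Sym2.eq_iff.1 h with ⟨h, -⟩ | ⟨h, -⟩
      · exact hx h
      · exact hx' h
    rw [Finset.mem_insert]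
    by_cases h : s(y, z) = s(u₁, v₁)
    · left; rw [h, Function.update_self]
    · right
      exact mem_farColors.2 ⟨y, z, hadj hy this, hadj hz h, by rw [Function.update_of_ne h]⟩
  have good₁ : GoodColoring G₁ (Function.update c s(u₁, v₁) k₁) := by
    refine GoodColoring.add_edge hG₁3 ?_ (hH₁ ▸ hc) (hH₁ ▸ hd₁) ?_
    · rw [hG₁, deleteEdges_adj]; exact ⟨h₁, hne⟩
    · rw [← hH₁]
      unfold AdmissibleColor at hk₁ ⊢
      rwa [nbr u₁ huu huv, nbr v₁ hvu hvv]
  refine ⟨_, GoodColoring.add_edge hG h₂ good₁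
    (hd₂.mono (near u₂ huu.symm hvu.symm) (near v₂ huv.symm hvv.symm)) (k := k₂) ?_⟩
  rcases hk₂ with ⟨h0, hu, hv⟩ | h
  · left
    have hkk : k₂ ≠ k₁ := fun h ↦ h0 (h.trans (hk h.symm))
    refine ⟨h0, fun h ↦ ?_, fun h ↦ ?_⟩
    · rcases Finset.mem_insert.1 (far u₂ huu.symm hvu.symm h) with h | h
      exacts [hkk h, hu h]
    · rcases Finset.mem_insert.1 (far v₂ huv.symm hvv.symm h) with h | h
      exacts [hkk h, hv h]
  · exact Or.inr h

open Classical in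
/-- Permute the colors of the edges not meeting `X`. -/
noncomputable def permuteOutside {V : Type} (X : Set V) (π : Equiv.Perm (Fin 8))
    (c : Sym2 V → Fin 8) : Sym2 V → Fin 8 :=
  fun e ↦ if ∃ x ∈ e, x ∈ X then c e else π (c e)

section Permute

variable {V : Type} {H : SimpleGraph V} {c : Sym2 V → Fin 8} {X : Set V}
  {π : Equiv.Perm (Fin 8)}

theorem permuteOutside_of_mem {a b : V} (ha : a ∈ X) :
    permuteOutside X π c s(a, b) = c s(a, b) :=
  if_pos ⟨a, by simp, ha⟩

theorem permuteOutside_of_notMem {a b : V} (ha : a ∉ X) (hb : b ∉ X) :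
    permuteOutside X π c s(a, b) = π (c s(a, b)) :=
  if_neg (by simp [ha, hb])

theorem GoodColoring.permuteOutside (hc : GoodColoring H c) (hπ : π 0 = 0)
    (hX : ∀ a b, H.Adj a b → (a ∈ X ↔ b ∈ X)) : GoodColoring H (permuteOutside X π c) := by
  have hπ' : ∀ k, π k = 0 ↔ k = 0 := fun k ↦
    ⟨fun h ↦ π.injective (h.trans hπ.symm), fun h ↦ h ▸ hπ⟩
  apply GoodColoring.of_paths
  · intro a b d hab hbd had
    have h1 := hX a b hab
    have h2 := hX b d hbd
    have := hc.ne hab hbd had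
    by_cases ha : a ∈ X
    · rwa [permuteOutside_of_mem ha, permuteOutside_of_mem (h1.1 ha)]
    · rw [permuteOutside_of_notMem ha (by tauto),
        permuteOutside_of_notMem (by tauto) (by tauto)]
      exact π.injective.ne this
  · intro a b d e hab hbd hde had hbe
    have h1 := hX a b hab
    have h2 := hX b d hbd
    have h3 := hX d e hde
    have := hc.eq_zero hab hbd hde had
    by_cases ha : a ∈ X
    · rwa [permuteOutside_of_mem ha, permuteOutside_of_mem (h2.1 (h1.1 ha))]
    · rw [permuteOutside_of_notMem ha (by tauto),
        permuteOutside_of_notMem (by tauto) (by tauto), hπ', π.injective.eq_iff]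
      exact this
  · intro a b hab
    have h1 := hX a b hab
    by_cases ha : a ∈ X
    · rw [permuteOutside_of_mem ha]
      exact fun h ↦ (hc.2 a b hab h).1
    · rw [permuteOutside_of_notMem ha (by tauto), hπ']
      exact fun h ↦ (hc.2 a b hab h).1

theorem nearColors_permuteOutside_of_mem {u : V} (hu : u ∈ X) :
    nearColors H (permuteOutside X π c) u = nearColors H c u := by
  ext k
  simp only [mem_nearColors, permuteOutside_of_mem hu]

theorem nearColors_permuteOutside_of_notMem (hX : ∀ a b, H.Adj a b → (a ∈ X ↔ b ∈ X)) {u : V}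
    (hu : u ∉ X) :
    nearColors H (permuteOutside X π c) u = (nearColors H c u).image π := by
  ext k
  simp only [mem_nearColors, Finset.mem_image]
  constructor
  · rintro ⟨x, hx, rfl⟩
    have := hX u x hx
    exact ⟨_, ⟨x, hx, rfl⟩, (permuteOutside_of_notMem hu (by tauto)).symm⟩
  · rintro ⟨_, ⟨x, hx, rfl⟩, rfl⟩
    have := hX u x hx
    exact ⟨x, hx, permuteOutside_of_notMem hu (by tauto)⟩

theorem farColors_permuteOutside_of_mem (hX : ∀ a b, H.Adj a b → (a ∈ X ↔ b ∈ X)) {u : V}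
    (hu : u ∈ X) :
    farColors H (permuteOutside X π c) u = farColors H c u := by
  ext k
  simp only [mem_farColors]
  refine exists_congr fun x ↦ exists_congr fun z ↦ and_congr_right fun hx ↦ ?_
  rw [permuteOutside_of_mem ((hX u x hx).1 hu)]

theorem farColors_permuteOutside_of_notMem (hX : ∀ a b, H.Adj a b → (a ∈ X ↔ b ∈ X)) {u : V}
    (hu : u ∉ X) :
    farColors H (permuteOutside X π c) u = (farColors H c u).image π := by
  ext k
  simp only [mem_farColors, Finset.mem_image]
  constructor
  · rintro ⟨x, z, hx, hz, rfl⟩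
    have := hX u x hx
    have := hX x z hz
    exact ⟨_, ⟨x, z, hx, hz, rfl⟩, (permuteOutside_of_notMem (by tauto) (by tauto)).symm⟩
  · rintro ⟨_, ⟨x, z, hx, hz, rfl⟩, rfl⟩
    have := hX u x hx
    have := hX x z hz
    exact ⟨x, z, hx, hz, permuteOutside_of_notMem (by tauto) (by tauto)⟩

end Permute

/-- A permutation may be changed outside `S` so that it maps `T \ S` outside `F`. -/
theorem exists_perm_avoiding (π : Equiv.Perm (Fin 8)) (S T F : Finset (Fin 8))
    (h : F.card + S.card + T.card ≤ 8) :
    ∃ π' : Equiv.Perm (Fin 8), (∀ x ∈ S, π' x = π x) ∧ ∀ x ∈ T, x ∉ S → π' x ∉ F := by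
  induction T using Finset.induction_on generalizing π S with
  | empty => exact ⟨π, fun _ _ ↦ rfl, by simp⟩
  | insert t T ht ih =>
    rw [Finset.card_insert_of_notMem ht] at h
    by_cases htS : t ∈ S
    · obtain ⟨π', h1, h2⟩ := ih π S (by omega)
      refine ⟨π', h1, fun x hx hxS ↦ ?_⟩
      rcases Finset.mem_insert.1 hx with rfl | hx
      · exact absurd htS hxS
      · exact h2 x hx hxS
    · have hcard : (F ∪ S.image π).card < (Finset.univ : Finset (Fin 8)).card := by
        have h1 := Finset.card_union_le F (S.image π)
        have h2 : (S.image π).card ≤ S.card := Finset.card_image_le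
        rw [Finset.card_univ, Fintype.card_fin]
        omega
      obtain ⟨y, -, hy⟩ := Finset.exists_mem_notMem_of_card_lt_card hcard
      rw [Finset.mem_union, not_or] at hy
      obtain ⟨π', h1, h2⟩ := ih (π.trans (Equiv.swap (π t) y)) (insert t S)
        (by rw [Finset.card_insert_of_notMem htS]; omega)
      refine ⟨π', fun x hx ↦ ?_, fun x hx hxS ↦ ?_⟩
      · rw [h1 x (Finset.mem_insert_of_mem hx), Equiv.trans_apply]
        apply Equiv.swap_apply_of_ne_of_ne
        · intro h'
          exact htS (π.injective h' ▸ hx)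
        · rintro rfl
          exact hy.2 (Finset.mem_image_of_mem _ hx)
      · by_cases hxt : x = t
        · subst hxt
          rw [h1 x (Finset.mem_insert_self _ _), Equiv.trans_apply, Equiv.swap_apply_left]
          exact hy.1
        · refine h2 x ((Finset.mem_insert.1 hx).resolve_left hxt) ?_
          simp [hxt, hxS]

theorem exists_color_notMem (S : Finset (Fin 8)) (h : S.card < 7) : ∃ k, k ≠ 0 ∧ k ∉ S := by
  have hcard : (insert 0 S).card < (Finset.univ : Finset (Fin 8)).card := by
    have := Finset.card_insert_le 0 S
    rw [Finset.card_univ, Fintype.card_fin]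
    omega
  obtain ⟨y, -, hy⟩ := Finset.exists_mem_notMem_of_card_lt_card hcard
  simp only [Finset.mem_insert, not_or] at hy
  exact ⟨y, hy⟩

theorem MinCounter.exists_coloring {V : Type} [Finite V] {G : SimpleGraph V}
    (hG : MinCounter V G) {H : SimpleGraph V} (hH : Subcubic H)
    (h : H.edgeSet.ncard < G.edgeSet.ncard) : ∃ c, GoodColoring H c :=
  hG.2.2 V H hH (by omega)

theorem ncard_edgeSet_deleteEdges_lt {V : Type} [Finite V] {G : SimpleGraph V} {e : Sym2 V}
    {s : Set (Sym2 V)} (he : e ∈ G.edgeSet) (hs : e ∈ s) :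
    (G.deleteEdges s).edgeSet.ncard < G.edgeSet.ncard := by
  rw [edgeSet_deleteEdges]
  exact Set.ncard_lt_ncard ⟨Set.sdiff_subset, fun h ↦ (h he).2 hs⟩

theorem MinCounter.exists_coloring_deleteEdges {V : Type} [Finite V] {G : SimpleGraph V}
    (hG : MinCounter V G) {e : Sym2 V} {s : Set (Sym2 V)} (he : e ∈ G.edgeSet) (hs : e ∈ s) :
    ∃ c, GoodColoring (G.deleteEdges s) c :=
  hG.exists_coloring (hG.1.mono (G.deleteEdges_le _)) (ncard_edgeSet_deleteEdges_lt he hs)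

/-- A minimal counterexample has no bridge. -/
theorem MinCounter.not_bridge {V : Type} [Finite V] {G : SimpleGraph V} (hG : MinCounter V G)
    {X : Set V} {u v : V} (hu : u ∈ X) (hv : v ∉ X) (huv : G.Adj u v)
    (hX : ∀ a ∈ X, ∀ b ∉ X, G.Adj a b → a = u ∧ b = v) : False := by
  obtain ⟨c, hc⟩ := hG.exists_coloring_deleteEdges (s := {s(u, v)}) huv rfl
  have du := ncard_neighborSet_deleteEdges_lt (s := {s(u, v)}) huv rfl
  have dv := ncard_neighborSet_deleteEdges_lt (s := {s(u, v)}) huv.symm Sym2.eq_swap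
  have hu3 := hG.1 u
  have hv3 := hG.1 v
  have hsub : Subcubic (G.deleteEdges {s(u, v)}) := hG.1.mono (G.deleteEdges_le _)
  have hX' : ∀ a b, (G.deleteEdges {s(u, v)}).Adj a b → (a ∈ X ↔ b ∈ X) := by
    intro a b hab
    rw [deleteEdges_adj] at hab
    by_contra h
    by_cases ha : a ∈ X
    · obtain ⟨rfl, rfl⟩ := hX a ha b (by tauto) hab.1
      exact hab.2 rfl
    · obtain ⟨rfl, rfl⟩ := hX b (by tauto) a ha hab.1.symm
      exact hab.2 Sym2.eq_swap
  set H := G.deleteEdges {s(u, v)}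
  have nu := card_nearColors_le (G := H) (c := c) (u := u)
  have nv := card_nearColors_le (G := H) (c := c) (u := v)
  obtain ⟨k, hk0, hk⟩ := exists_color_notMem (farColors H c u)
    ((card_farColors_le hsub).trans_lt (by omega))
  obtain ⟨m, hm0, hm⟩ := exists_color_notMem (farColors H c v)
    ((card_farColors_le hsub).trans_lt (by omega))
  have z := hc.zero_notMem_nearColors (u := v) (by omega)
  obtain ⟨π, h1, h2⟩ := exists_perm_avoiding (Equiv.swap m k) {0, m} (nearColors H c v)
    (nearColors H c u) (by have := Finset.card_le_two (a := (0 : Fin 8)) (b := m); omega)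
  have hπ0 : π 0 = 0 := by
    rw [h1 0 (by simp)]
    exact Equiv.swap_apply_of_ne_of_ne hm0.symm hk0.symm
  have hπm : π m = k := by
    rw [h1 m (by simp), Equiv.swap_apply_left]
  refine hG.2.1 ⟨_, GoodColoring.add_edge hG.1 huv (hc.permuteOutside (X := X) hπ0 hX')
    (k := k) ?_ (Or.inl ⟨hk0, ?_, ?_⟩)⟩
  · rw [nearColors_permuteOutside_of_mem hu, nearColors_permuteOutside_of_notMem hX' hv,
      Finset.disjoint_right]
    intro x hx
    obtain ⟨y, hy, rfl⟩ := Finset.mem_image.1 hx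
    refine h2 y hy ?_
    simp only [Finset.mem_insert, Finset.mem_singleton, not_or]
    exact ⟨fun h ↦ z (h ▸ hy), fun h ↦ hm (nearColors_subset_farColors (h ▸ hy))⟩
  · rwa [farColors_permuteOutside_of_mem hX' hu]
  · rw [farColors_permuteOutside_of_notMem hX' hv, Finset.mem_image]
    rintro ⟨y, hy, h⟩
    exact hm (π.injective (h.trans hπm.symm) ▸ hy)

/-- `u₁v₁` and `u₂v₂` are disjoint edges and are the only edges leaving `X`. -/
structure MatchingCut {V : Type} (G : SimpleGraph V) (X : Set V) (u₁ v₁ u₂ v₂ : V) : Prop where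
  u₁_mem : u₁ ∈ X
  u₂_mem : u₂ ∈ X
  v₁_notMem : v₁ ∉ X
  v₂_notMem : v₂ ∉ X
  adj₁ : G.Adj u₁ v₁
  adj₂ : G.Adj u₂ v₂
  u_ne : u₁ ≠ u₂
  v_ne : v₁ ≠ v₂
  eq_or_eq : ∀ a ∈ X, ∀ b ∉ X, G.Adj a b → (a = u₁ ∧ b = v₁) ∨ (a = u₂ ∧ b = v₂)

section MatchingCut

variable {V : Type} {G : SimpleGraph V} {X : Set V} {u₁ v₁ u₂ v₂ : V}

theorem MatchingCut.swap (h : MatchingCut G X u₁ v₁ u₂ v₂) : MatchingCut G X u₂ v₂ u₁ v₁ :=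
  ⟨h.u₂_mem, h.u₁_mem, h.v₂_notMem, h.v₁_notMem, h.adj₂, h.adj₁, h.u_ne.symm, h.v_ne.symm,
    fun a ha b hb hab ↦ (h.eq_or_eq a ha b hb hab).symm⟩

theorem MatchingCut.compl (h : MatchingCut G X u₁ v₁ u₂ v₂) : MatchingCut G Xᶜ v₁ u₁ v₂ u₂ :=
  ⟨h.v₁_notMem, h.v₂_notMem, not_not.2 h.u₁_mem, not_not.2 h.u₂_mem, h.adj₁.symm, h.adj₂.symm,
    h.v_ne, h.u_ne, fun a ha b hb hab ↦
      (h.eq_or_eq b (not_not.1 hb) a ha hab.symm).imp And.symm And.symm⟩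

theorem MatchingCut.mem_iff (h : MatchingCut G X u₁ v₁ u₂ v₂) (a b : V)
    (hab : (G.deleteEdges {s(u₁, v₁), s(u₂, v₂)}).Adj a b) : a ∈ X ↔ b ∈ X := by
  rw [deleteEdges_adj] at hab
  by_contra hn
  apply hab.2
  by_cases ha : a ∈ X
  · rcases h.eq_or_eq a ha b (by tauto) hab.1 with ⟨rfl, rfl⟩ | ⟨rfl, rfl⟩ <;> simp
  · rcases h.eq_or_eq b (by tauto) a ha hab.1.symm with ⟨rfl, rfl⟩ | ⟨rfl, rfl⟩ <;>
      simp [Sym2.eq_swap]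

variable [Finite V] {H : SimpleGraph V} {c : Sym2 V → Fin 8}

theorem MatchingCut.exists_coloring (h : MatchingCut G X u₁ v₁ u₂ v₂) (hG : Subcubic G)
    (hH : H = G.deleteEdges {s(u₁, v₁), s(u₂, v₂)}) (hc : GoodColoring H c)
    (π : Equiv.Perm (Fin 8)) (hπ : π 0 = 0) {k₁ k₂ : Fin 8} (hk : k₁ = k₂ → k₁ = 0)
    (hd₁ : ∀ k ∈ nearColors H c v₁, π k ∉ nearColors H c u₁)
    (hd₂ : ∀ k ∈ nearColors H c v₂, π k ∉ nearColors H c u₂)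
    (hk₁ : AdmissibleColor G u₁ v₁ (farColors H c u₁) ((farColors H c v₁).image π) k₁)
    (hk₂ : AdmissibleColor G u₂ v₂ (farColors H c u₂) ((farColors H c v₂).image π) k₂) :
    ∃ c', GoodColoring G c' := by
  have hX : ∀ a b, H.Adj a b → (a ∈ X ↔ b ∈ X) := hH ▸ h.mem_iff
  have ne : ∀ {a b}, a ∈ X → b ∉ X → a ≠ b := fun ha hb h ↦ hb (h ▸ ha)
  refine GoodColoring.add_two_edges hG h.adj₁ h.adj₂ h.u_ne (ne h.u₁_mem h.v₂_notMem)
    (ne h.u₂_mem h.v₁_notMem).symm h.v_ne hH (hc.permuteOutside (X := X) hπ hX) hk ?_ ?_ ?_ ?_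
  · rw [nearColors_permuteOutside_of_mem h.u₁_mem,
      nearColors_permuteOutside_of_notMem hX h.v₁_notMem, Finset.disjoint_right]
    simpa using hd₁
  · rw [nearColors_permuteOutside_of_mem h.u₂_mem,
      nearColors_permuteOutside_of_notMem hX h.v₂_notMem, Finset.disjoint_right]
    simpa using hd₂
  · rwa [farColors_permuteOutside_of_mem hX h.u₁_mem,
      farColors_permuteOutside_of_notMem hX h.v₁_notMem]
  · rwa [farColors_permuteOutside_of_mem hX h.u₂_mem,
      farColors_permuteOutside_of_notMem hX h.v₂_notMem]

theorem MatchingCut.degree_lt (h : MatchingCut G X u₁ v₁ u₂ v₂)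
    (hH : H = G.deleteEdges {s(u₁, v₁), s(u₂, v₂)}) :
    (H.neighborSet u₁).ncard < (G.neighborSet u₁).ncard ∧
    (H.neighborSet v₁).ncard < (G.neighborSet v₁).ncard ∧
    (H.neighborSet u₂).ncard < (G.neighborSet u₂).ncard ∧
    (H.neighborSet v₂).ncard < (G.neighborSet v₂).ncard := by
  subst hH
  exact ⟨ncard_neighborSet_deleteEdges_lt h.adj₁ (by simp),
    ncard_neighborSet_deleteEdges_lt h.adj₁.symm (by simp [Sym2.eq_swap]),
    ncard_neighborSet_deleteEdges_lt h.adj₂ (by simp),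
    ncard_neighborSet_deleteEdges_lt h.adj₂.symm (by simp [Sym2.eq_swap])⟩

end MatchingCut

theorem MatchingCut.false_of_three {V : Type} [Finite V] {G : SimpleGraph V} {X : Set V}
    {u₁ v₁ u₂ v₂ : V} (hG : MinCounter V G) (h : MatchingCut G X u₁ v₁ u₂ v₂)
    (hu₁ : (G.neighborSet u₁).ncard = 3) (hv₁ : (G.neighborSet v₁).ncard = 3)
    (hu₂ : (G.neighborSet u₂).ncard = 3) (hv₂ : (G.neighborSet v₂).ncard = 3) : False := by
  obtain ⟨H, hH⟩ : ∃ H, H = G.deleteEdges {s(u₁, v₁), s(u₂, v₂)} := ⟨_, rfl⟩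
  obtain ⟨c, hc⟩ : ∃ c, GoodColoring H c :=
    hH ▸ hG.exists_coloring_deleteEdges h.adj₁ (Set.mem_insert _ _)
  obtain ⟨du₁, dv₁, du₂, dv₂⟩ := h.degree_lt hH
  have a₁ := card_nearColors_le (G := H) (c := c) (u := u₁)
  have b₁ := card_nearColors_le (G := H) (c := c) (u := v₁)
  have a₂ := card_nearColors_le (G := H) (c := c) (u := u₂)
  have b₂ := card_nearColors_le (G := H) (c := c) (u := v₂)
  have z₁ := hc.zero_notMem_nearColors (u := v₁) (by omega)
  have z₂ := hc.zero_notMem_nearColors (u := v₂) (by omega)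
  obtain ⟨π, p1, p2⟩ := exists_perm_avoiding 1 {0} (nearColors H c v₁)
    (nearColors H c u₁ ∪ nearColors H c u₂) (by
      have := Finset.card_union_le (nearColors H c u₁) (nearColors H c u₂)
      rw [Finset.card_singleton]
      omega)
  obtain ⟨σ, q1, q2⟩ := exists_perm_avoiding π (insert 0 (nearColors H c v₁))
    (nearColors H c v₂) (nearColors H c u₂) (by
      have := Finset.card_insert_le 0 (nearColors H c v₁)
      omega)
  have hσ : σ 0 = 0 := by rw [q1 0 (by simp), p1 0 (by simp)]; rfl
  have hb₁ : ∀ k ∈ nearColors H c v₁, σ k ∉ nearColors H c u₁ ∪ nearColors H c u₂ := by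
    intro k hk
    rw [q1 k (by simp [hk])]
    exact p2 k hk (by rw [Finset.mem_singleton]; exact fun h ↦ z₁ (h ▸ hk))
  refine hG.2.1 (h.exists_coloring hG.1 hH hc σ hσ (k₁ := 0) (k₂ := 0) (fun _ ↦ rfl)
    (fun k hk h' ↦ hb₁ k hk (Finset.mem_union_left _ h')) (fun k hk ↦ ?_)
    (Or.inr ⟨rfl, hu₁, hv₁⟩) (Or.inr ⟨rfl, hu₂, hv₂⟩))
  by_cases hk' : k ∈ nearColors H c v₁
  · exact fun h' ↦ hb₁ k hk' (Finset.mem_union_right _ h')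
  · exact q2 k hk (by simp only [Finset.mem_insert, not_or]; exact ⟨fun h ↦ z₂ (h ▸ hk), hk'⟩)

theorem MatchingCut.false_of_two_of_three {V : Type} [Finite V] {G : SimpleGraph V} {X : Set V}
    {u₁ v₁ u₂ v₂ : V} (hG : MinCounter V G) (h : MatchingCut G X u₁ v₁ u₂ v₂)
    (hu₁ : (G.neighborSet u₁).ncard ≤ 2)
    (hu₂ : (G.neighborSet u₂).ncard = 3) (hv₂ : (G.neighborSet v₂).ncard = 3) : False := by
  obtain ⟨H, hH⟩ : ∃ H, H = G.deleteEdges {s(u₁, v₁), s(u₂, v₂)} := ⟨_, rfl⟩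
  obtain ⟨c, hc⟩ : ∃ c, GoodColoring H c :=
    hH ▸ hG.exists_coloring_deleteEdges h.adj₁ (Set.mem_insert _ _)
  obtain ⟨du₁, dv₁, du₂, dv₂⟩ := h.degree_lt hH
  have hv₁ := hG.1 v₁
  have hsub : Subcubic H := hG.1.mono (hH ▸ G.deleteEdges_le _)
  have b₁ := card_nearColors_le (G := H) (c := c) (u := v₁)
  have a₂ := card_nearColors_le (G := H) (c := c) (u := u₂)
  have b₂ := card_nearColors_le (G := H) (c := c) (u := v₂)
  have A₁ := card_farColors_le (c := c) (u := u₁) hsub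
  have B₁ := card_farColors_le (c := c) (u := v₁) hsub
  have t₁ := nearColors_subset_farColors (G := H) (c := c) (u := v₁)
  have z₁ := hc.zero_notMem_nearColors (u := v₁) (by omega)
  have z₂ := hc.zero_notMem_nearColors (u := v₂) (by omega)
  have un := Finset.card_union_le (farColors H c u₁) (nearColors H c u₂)
  have un' := Finset.card_union_le (nearColors H c u₁) (nearColors H c u₂)
  have a₁ := card_nearColors_le (G := H) (c := c) (u := u₁)
  obtain ⟨m, hm0, hm⟩ := exists_color_notMem (farColors H c v₁) (by omega)
  obtain ⟨ρ, o1, o2⟩ := exists_perm_avoiding 1 {0} {m} (farColors H c u₁ ∪ nearColors H c u₂) (by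
      rw [Finset.card_singleton, Finset.card_singleton]
      omega)
  have c2 := Finset.card_le_two (a := (0 : Fin 8)) (b := m)
  obtain ⟨π, p1, p2⟩ := exists_perm_avoiding ρ {0, m} (nearColors H c v₁)
    (nearColors H c u₁ ∪ nearColors H c u₂) (by omega)
  obtain ⟨σ, q1, q2⟩ := exists_perm_avoiding π ({0, m} ∪ nearColors H c v₁)
    (nearColors H c v₂) (nearColors H c u₂) (by
      have := Finset.card_union_le {0, m} (nearColors H c v₁)
      omega)
  have hσ : σ 0 = 0 := by rw [q1 0 (by simp), p1 0 (by simp), o1 0 (by simp)]; rfl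
  have hσm : σ m ∉ farColors H c u₁ ∪ nearColors H c u₂ := by
    rw [q1 m (by simp), p1 m (by simp)]
    exact o2 m (by simp) (by simpa using hm0)
  rw [Finset.mem_union, not_or] at hσm
  have hb₁ : ∀ k ∈ nearColors H c v₁, σ k ∉ nearColors H c u₁ ∪ nearColors H c u₂ := by
    intro k hk
    rw [q1 k (by simp [hk])]
    refine p2 k hk ?_
    simp only [Finset.mem_insert, Finset.mem_singleton, not_or]
    exact ⟨fun h ↦ z₁ (h ▸ hk), fun h ↦ hm (t₁ (h ▸ hk))⟩
  have hσm0 : σ m ≠ 0 := fun h ↦ hm0 (σ.injective (h.trans hσ.symm))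
  refine hG.2.1 (h.exists_coloring hG.1 hH hc σ hσ (k₁ := σ m) (k₂ := 0) id
    (fun k hk h' ↦ hb₁ k hk (Finset.mem_union_left _ h')) (fun k hk ↦ ?_)
    (Or.inl ⟨hσm0, hσm.1, by simpa using hm⟩)
    (Or.inr ⟨rfl, hu₂, hv₂⟩))
  by_cases hk' : k ∈ nearColors H c v₁
  · exact fun h' ↦ hb₁ k hk' (Finset.mem_union_right _ h')
  by_cases hkm : k = m
  · exact hkm ▸ hσm.2
  · refine q2 k hk ?_
    simp only [Finset.mem_union, Finset.mem_insert, Finset.mem_singleton, not_or]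
    exact ⟨⟨fun h ↦ z₂ (h ▸ hk), hkm⟩, hk'⟩

theorem MatchingCut.false_of_two_of_two {V : Type} [Finite V] {G : SimpleGraph V} {X : Set V}
    {u₁ v₁ u₂ v₂ : V} (hG : MinCounter V G) (h : MatchingCut G X u₁ v₁ u₂ v₂)
    (hu₁ : (G.neighborSet u₁).ncard ≤ 2) (hv₂ : (G.neighborSet v₂).ncard ≤ 2) : False := by
  obtain ⟨H, hH⟩ : ∃ H, H = G.deleteEdges {s(u₁, v₁), s(u₂, v₂)} := ⟨_, rfl⟩
  obtain ⟨c, hc⟩ : ∃ c, GoodColoring H c :=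
    hH ▸ hG.exists_coloring_deleteEdges h.adj₁ (Set.mem_insert _ _)
  obtain ⟨du₁, dv₁, du₂, dv₂⟩ := h.degree_lt hH
  have hv₁ := hG.1 v₁
  have hu₂ := hG.1 u₂
  have hsub : Subcubic H := hG.1.mono (hH ▸ G.deleteEdges_le _)
  have a₁ := card_nearColors_le (G := H) (c := c) (u := u₁)
  have b₁ := card_nearColors_le (G := H) (c := c) (u := v₁)
  have a₂ := card_nearColors_le (G := H) (c := c) (u := u₂)
  have b₂ := card_nearColors_le (G := H) (c := c) (u := v₂)
  have A₁ := card_farColors_le (c := c) (u := u₁) hsub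
  have A₂ := card_farColors_le (c := c) (u := u₂) hsub
  have B₁ := card_farColors_le (c := c) (u := v₁) hsub
  have B₂ := card_farColors_le (c := c) (u := v₂) hsub
  have t₁ := nearColors_subset_farColors (G := H) (c := c) (u := v₁)
  have s₂ := nearColors_subset_farColors (G := H) (c := c) (u := u₂)
  have t₂ := nearColors_subset_farColors (G := H) (c := c) (u := v₂)
  have z₁ := hc.zero_notMem_nearColors (u := v₁) (by omega)
  have z₂ := hc.zero_notMem_nearColors (u := v₂) (by omega)
  have un := Finset.card_union_le (farColors H c u₁) (nearColors H c u₂)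
  have un' := Finset.card_union_le (nearColors H c u₁) (nearColors H c u₂)
  obtain ⟨m, hm0, hm⟩ := exists_color_notMem (farColors H c v₁) (by omega)
  obtain ⟨k₂, hk₂0, hk₂⟩ := exists_color_notMem (farColors H c u₂) (by omega)
  obtain ⟨p, hp0, hp⟩ := exists_color_notMem
    (insert m (farColors H c v₂ ∪ nearColors H c v₁)) (by
      have := Finset.card_insert_le m (farColors H c v₂ ∪ nearColors H c v₁)
      have := Finset.card_union_le (farColors H c v₂) (nearColors H c v₁)
      omega)
  simp only [Finset.mem_insert, Finset.mem_union, not_or] at hp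
  obtain ⟨hpm, hpB, hpb⟩ := hp
  have c2 := Finset.card_le_two (a := (0 : Fin 8)) (b := p)
  have c3 := Finset.card_le_three (a := (0 : Fin 8)) (b := p) (c := m)
  obtain ⟨ρ, o1, o2⟩ := exists_perm_avoiding (Equiv.swap p k₂) {0, p} {m}
    (farColors H c u₁ ∪ nearColors H c u₂) (by
      rw [Finset.card_singleton]
      omega)
  obtain ⟨π, p1, p2⟩ := exists_perm_avoiding ρ {0, p, m} (nearColors H c v₁)
    (nearColors H c u₁ ∪ nearColors H c u₂) (by omega)
  obtain ⟨σ, q1, q2⟩ := exists_perm_avoiding π ({0, p, m} ∪ nearColors H c v₁)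
    (nearColors H c v₂) (nearColors H c u₂) (by
      have := Finset.card_union_le {0, p, m} (nearColors H c v₁)
      omega)
  have hσ : σ 0 = 0 := by
    rw [q1 0 (by simp), p1 0 (by simp), o1 0 (by simp)]
    exact Equiv.swap_apply_of_ne_of_ne hp0.symm hk₂0.symm
  have hσp : σ p = k₂ := by
    rw [q1 p (by simp), p1 p (by simp), o1 p (by simp), Equiv.swap_apply_left]
  have hσm : σ m ∉ farColors H c u₁ ∪ nearColors H c u₂ := by
    rw [q1 m (by simp), p1 m (by simp)]
    exact o2 m (by simp) (by simpa using ⟨hm0, fun h ↦ hpm h.symm⟩)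
  rw [Finset.mem_union, not_or] at hσm
  have hb₁ : ∀ k ∈ nearColors H c v₁, σ k ∉ nearColors H c u₁ ∪ nearColors H c u₂ := by
    intro k hk
    rw [q1 k (by simp [hk])]
    refine p2 k hk ?_
    simp only [Finset.mem_insert, Finset.mem_singleton, not_or]
    exact ⟨fun h ↦ z₁ (h ▸ hk), fun h ↦ hpb (h ▸ hk), fun h ↦ hm (t₁ (h ▸ hk))⟩
  have hσm0 : σ m ≠ 0 := fun h ↦ hm0 (σ.injective (h.trans hσ.symm))
  refine hG.2.1 (h.exists_coloring hG.1 hH hc σ hσ (k₁ := σ m) (k₂ := k₂)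
    (fun h ↦ absurd (σ.injective (hσp.trans h.symm)) hpm)
    (fun k hk h' ↦ hb₁ k hk (Finset.mem_union_left _ h')) (fun k hk ↦ ?_)
    (Or.inl ⟨hσm0, hσm.1, by simpa using hm⟩)
    (Or.inl ⟨hk₂0, hk₂, by rw [← hσp]; simpa using hpB⟩))
  by_cases hk' : k ∈ nearColors H c v₁
  · exact fun h' ↦ hb₁ k hk' (Finset.mem_union_right _ h')
  by_cases hkm : k = m
  · exact hkm ▸ hσm.2
  · refine q2 k hk ?_
    simp only [Finset.mem_union, Finset.mem_insert, Finset.mem_singleton, not_or]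
    exact ⟨⟨fun h ↦ z₂ (h ▸ hk), fun h ↦ hpB (t₂ (h ▸ hk)), hkm⟩, hk'⟩

/-- A minimal counterexample has no path of length three with distinct ends whose inner vertices
have degree two. -/
theorem MinCounter.not_adj_of_two_of_two {V : Type} [Finite V] {G : SimpleGraph V}
    (hG : MinCounter V G) {p q p' q' : V} (hp : G.neighborSet p = {p', q})
    (hq : G.neighborSet q = {p, q'}) (hne : p' ≠ q') (hp'q : p' ≠ q) (hq'p : q' ≠ p) : False := by
  classical
  have Np : ∀ x, G.Adj p x ↔ x = p' ∨ x = q := fun x ↦ by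
    rw [← mem_neighborSet, hp]; simp
  have Nq : ∀ x, G.Adj q x ↔ x = p ∨ x = q' := fun x ↦ by
    rw [← mem_neighborSet, hq]; simp
  have hpq : G.Adj p q := (Np q).2 (Or.inr rfl)
  have hqq' : G.Adj q q' := (Nq q').2 (Or.inr rfl)
  set G' := G.deleteEdges {s(p, q)} with hG'
  have adj' : ∀ {x y}, G'.Adj x y ↔ G.Adj x y ∧ s(x, y) ≠ s(p, q) := by
    intro x y; rw [hG', deleteEdges_adj]; rfl
  have Np' : ∀ {x}, G'.Adj p x ↔ x = p' := by
    intro x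
    rw [adj', Np, Ne, Sym2.congr_right]
    constructor
    · rintro ⟨h | h, h'⟩
      exacts [h, absurd h h']
    · rintro rfl
      exact ⟨Or.inl rfl, hp'q⟩
  have Nq' : ∀ {x}, G'.Adj q x ↔ x = q' := by
    intro x
    rw [adj', Nq, Ne, Sym2.eq_swap (a := p), Sym2.congr_right]
    constructor
    · rintro ⟨h | h, h'⟩
      exacts [absurd h h', h]
    · rintro rfl
      exact ⟨Or.inr rfl, hq'p⟩
  let φ : V → V := fun x ↦ if x = q then p else x
  have φq : φ q = p := if_pos rfl
  have φne : ∀ {x}, x ≠ q → φ x = x := fun h ↦ if_neg h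
  have φinj : ∀ {a b d}, G'.Adj a b → G'.Adj b d → a ≠ d → φ a ≠ φ d := by
    intro a b d hab hbd had h
    by_cases ha : a = q
    · subst ha
      rw [φq, φne had.symm] at h
      subst h
      exact hne ((Np'.1 hbd.symm).symm.trans (Nq'.1 hab))
    · by_cases hd : d = q
      · subst hd
        rw [φq, φne ha] at h
        subst h
        exact hne ((Np'.1 hab).symm.trans (Nq'.1 hbd.symm))
      · rw [φne ha, φne hd] at h
        exact had h
  let H : SimpleGraph V :=
    { Adj := fun x y ↦ x ≠ y ∧ ∃ a b, G'.Adj a b ∧ φ a = x ∧ φ b = y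
      symm := ⟨fun x y ⟨h, a, b, hab, ha, hb⟩ ↦ ⟨h.symm, b, a, hab.symm, hb, ha⟩⟩
      loopless := ⟨fun x h ↦ h.1 rfl⟩ }
  have φadj : ∀ {a b}, G'.Adj a b → H.Adj (φ a) (φ b) := by
    intro a b hab
    refine ⟨fun h ↦ ?_, a, b, hab, rfl, rfl⟩
    by_cases ha : a = q
    · subst ha
      rw [φq, φne hab.ne', Nq'.1 hab] at h
      exact hq'p h.symm
    · by_cases hb : b = q
      · subst hb
        rw [φq, φne ha, Nq'.1 hab.symm] at h
        exact hq'p h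
      · rw [φne ha, φne hb] at h
        exact hab.ne h
  have hcard : H.edgeSet.ncard < G.edgeSet.ncard := by
    have h1 : H.edgeSet ⊆ Sym2.map φ '' G'.edgeSet := by
      intro e
      induction e with | _ x y
      rintro ⟨-, a, b, hab, rfl, rfl⟩
      exact ⟨s(a, b), hab, rfl⟩
    exact ((Set.ncard_le_ncard h1).trans (Set.ncard_image_le (Set.toFinite _))).trans_lt
      (ncard_edgeSet_deleteEdges_lt hpq rfl)
  have Hp : (H.neighborSet p).ncard ≤ 2 := by
    have : H.neighborSet p ⊆ {p', q'} := by
      rintro x ⟨-, a, b, hab, ha, rfl⟩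
      by_cases h : a = q
      · subst h
        rw [Nq'.1 hab, φne (by rintro rfl; exact hqq'.ne rfl)]
        simp
      · rw [φne h] at ha
        subst ha
        rw [Np'.1 hab, φne hp'q]
        simp
    exact (Set.ncard_le_ncard this).trans ((Set.ncard_insert_le _ _).trans (by simp))
  have Hx : ∀ x, x ≠ p → (H.neighborSet x).ncard ≤ (G'.neighborSet x).ncard := by
    intro x hx
    have : H.neighborSet x ⊆ φ '' G'.neighborSet x := by
      rintro y ⟨-, a, b, hab, ha, rfl⟩
      have haq : a ≠ q := by
        rintro rfl
        exact hx (ha.symm.trans φq)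
      rw [φne haq] at ha
      subst ha
      exact ⟨b, hab, rfl⟩
    exact (Set.ncard_le_ncard this).trans Set.ncard_image_le
  have hG'sub : Subcubic G' := hG.1.mono (G.deleteEdges_le _)
  have hsub : Subcubic H := by
    intro x
    by_cases hx : x = p
    · subst hx; omega
    · exact (Hx x hx).trans (hG'sub x)
  obtain ⟨c, hc⟩ := hG.exists_coloring hsub hcard
  have hc' : GoodColoring G' (fun e ↦ c (e.map φ)) := by
    apply GoodColoring.of_paths
    · intro a b d hab hbd had
      exact hc.ne (φadj hab) (φadj hbd) (φinj hab hbd had)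
    · intro a b d e hab hbd hde had hbe
      exact hc.eq_zero (φadj hab) (φadj hbd) (φadj hde) (φinj hab hbd had)
    · intro a b hab h
      have h3 := (hc.2 _ _ (φadj hab) h).1
      have ha : φ a ≠ p := by
        intro h
        rw [h] at h3
        omega
      have haq : a ≠ q := by
        rintro rfl
        exact ha φq
      rw [φne haq] at h3 ha
      exact le_antisymm (hG'sub a) (h3 ▸ Hx a ha)
  have cp : (G'.neighborSet p).ncard = 1 := by
    rw [show G'.neighborSet p = {p'} by ext x; simp [Np'], Set.ncard_singleton]
  have cq : (G'.neighborSet q).ncard = 1 := by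
    rw [show G'.neighborSet q = {q'} by ext x; simp [Nq'], Set.ncard_singleton]
  have fp := card_farColors_le (c := fun e ↦ c (e.map φ)) (u := p) hG'sub
  have fq := card_farColors_le (c := fun e ↦ c (e.map φ)) (u := q) hG'sub
  obtain ⟨k, hk0, hk⟩ := exists_color_notMem (farColors G' (fun e ↦ c (e.map φ)) p ∪
    farColors G' (fun e ↦ c (e.map φ)) q) (by
      have := Finset.card_union_le (farColors G' (fun e ↦ c (e.map φ)) p)
        (farColors G' (fun e ↦ c (e.map φ)) q)
      omega)
  rw [Finset.mem_union, not_or] at hk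
  refine hG.2.1 ⟨_, GoodColoring.add_edge hG.1 hpq hc' (k := k) ?_ (Or.inl ⟨hk0, hk.1, hk.2⟩)⟩
  rw [Finset.disjoint_left]
  intro j hj hj'
  obtain ⟨x, hx, rfl⟩ := mem_nearColors.1 hj
  obtain ⟨y, hy, h⟩ := mem_nearColors.1 hj'
  have hx' := Np'.1 hx
  have hy' := Nq'.1 hy
  subst hx' hy'
  have h1 := φadj hx
  have h2 := φadj hy
  have hyq : y ≠ q := hqq'.ne'
  simp only [Sym2.map_mk, φq] at h
  rw [φne hpq.ne, φne hp'q] at h h1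
  rw [φne hyq] at h h2
  rw [φq] at h2
  refine hc.ne h1.symm h2 hne ?_
  rw [Sym2.eq_swap]
  exact h.symm

theorem MatchingCut.false_of_two_of_two_same_side {V : Type} [Finite V] {G : SimpleGraph V}
    {X : Set V} {u₁ v₁ u₂ v₂ : V} (hG : MinCounter V G) (h : MatchingCut G X u₁ v₁ u₂ v₂)
    (hu₁ : (G.neighborSet u₁).ncard ≤ 2) (hu₂ : (G.neighborSet u₂).ncard ≤ 2) : False := by
  have nbrs : ∀ {u v x : V}, (G.neighborSet u).ncard ≤ 2 → G.Adj u v → G.Adj u x → x ≠ v →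
      G.neighborSet u = {v, x} := by
    intro u v x hu hv hx hxv
    refine (Set.eq_of_subset_of_ncard_le ?_ ?_).symm
    · rintro y (rfl | rfl)
      exacts [hv, hx]
    · rwa [Set.ncard_pair hxv.symm]
  have ne : ∀ {a b}, a ∈ X → b ∉ X → a ≠ b := fun ha hb h ↦ hb (h ▸ ha)
  by_cases hx : ∃ x, G.Adj u₁ x ∧ x ≠ v₁
  · obtain ⟨x, hx, hxv⟩ := hx
    have N₁ := nbrs hu₁ h.adj₁ hx hxv
    by_cases hxu : x = u₂
    · subst hxu
      exact hG.not_adj_of_two_of_two N₁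
        ((nbrs hu₂ h.adj₂ hx.symm (ne h.u₁_mem h.v₂_notMem)).trans (Set.pair_comm _ _)) h.v_ne
        hxv.symm (ne h.u₁_mem h.v₂_notMem).symm
    · have hxX : x ∈ X := by
        by_contra hxX
        rcases h.eq_or_eq u₁ h.u₁_mem x hxX hx with h' | h'
        exacts [hxv h'.2, h.u_ne h'.1]
      have h' : MatchingCut G (X \ {u₁}) u₂ v₂ x u₁ :=
        { u₁_mem := ⟨h.u₂_mem, h.u_ne.symm⟩
          u₂_mem := ⟨hxX, hx.ne'⟩
          v₁_notMem := fun h' ↦ h.v₂_notMem h'.1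
          v₂_notMem := fun h' ↦ h'.2 rfl
          adj₁ := h.adj₂
          adj₂ := hx.symm
          u_ne := Ne.symm hxu
          v_ne := (ne h.u₁_mem h.v₂_notMem).symm
          eq_or_eq := by
            rintro a ⟨ha, hau⟩ b hb hab
            by_cases hbu : b = u₁
            · subst hbu
              have : a ∈ G.neighborSet b := hab.symm
              rw [N₁] at this
              rcases this with rfl | rfl
              · exact absurd ha h.v₁_notMem
              · exact Or.inr ⟨rfl, rfl⟩
            · rcases h.eq_or_eq a ha b (fun hbX ↦ hb ⟨hbX, hbu⟩) hab with h' | h'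
              · exact absurd h'.1 hau
              · exact Or.inl h' }
      exact h'.false_of_two_of_two hG hu₂ hu₁
  · refine hG.not_bridge (X := {u₁}) rfl (v := v₁) h.adj₁.ne' h.adj₁ ?_
    rintro a rfl b - hab
    refine ⟨rfl, ?_⟩
    by_contra hb
    exact hx ⟨b, hab, hb⟩

theorem MinCounter.not_matchingCut {V : Type} [Finite V] {G : SimpleGraph V} {X : Set V}
    {u₁ v₁ u₂ v₂ : V} (hG : MinCounter V G) (h : MatchingCut G X u₁ v₁ u₂ v₂) : False := by
  have three : ∀ {w}, ¬ (G.neighborSet w).ncard ≤ 2 → (G.neighborSet w).ncard = 3 := by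
    intro w hw
    have := hG.1 w
    omega
  by_cases hu₁ : (G.neighborSet u₁).ncard ≤ 2 <;> by_cases hv₁ : (G.neighborSet v₁).ncard ≤ 2 <;>
    by_cases hu₂ : (G.neighborSet u₂).ncard ≤ 2 <;> by_cases hv₂ : (G.neighborSet v₂).ncard ≤ 2
  all_goals first
    | exact h.false_of_two_of_two_same_side hG hu₁ hu₂
    | exact h.compl.false_of_two_of_two_same_side hG hv₁ hv₂
    | exact h.false_of_two_of_two hG hu₁ hv₂
    | exact h.swap.false_of_two_of_two hG hu₂ hv₁
    | exact h.false_of_two_of_three hG hu₁ (three hu₂) (three hv₂)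
    | exact h.compl.false_of_two_of_three hG hv₁ (three hv₂) (three hu₂)
    | exact h.swap.false_of_two_of_three hG hu₂ (three hu₁) (three hv₁)
    | exact h.swap.compl.false_of_two_of_three hG hv₂ (three hv₁) (three hu₁)
    | exact h.false_of_three hG (three hu₁) (three hv₁) (three hu₂) (three hv₂)

/-- If two edges at `u` are the only edges leaving `X`, then `u` has degree two. -/
theorem MinCounter.ncard_neighborSet_eq_two {V : Type} [Finite V] {G : SimpleGraph V} {X : Set V}
    {u v₁ v₂ : V} (hG : MinCounter V G) (hu : u ∈ X) (hv₁ : v₁ ∉ X) (hv₂ : v₂ ∉ X)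
    (h₁ : G.Adj u v₁) (h₂ : G.Adj u v₂) (hne : v₁ ≠ v₂)
    (hX : ∀ a ∈ X, ∀ b ∉ X, G.Adj a b → a = u ∧ (b = v₁ ∨ b = v₂)) :
    (G.neighborSet u).ncard = 2 := by
  have hpair : ({v₁, v₂} : Set V) ⊆ G.neighborSet u := by
    rintro y (rfl | rfl)
    exacts [h₁, h₂]
  by_contra h
  have h3 := hG.1 u
  obtain ⟨w, hw, hw'⟩ : ∃ w ∈ G.neighborSet u, w ∉ ({v₁, v₂} : Set V) := by
    by_contra! hc
    exact h (by rw [Set.Subset.antisymm hc hpair, Set.ncard_pair hne])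
  have hN : G.neighborSet u = {w, v₁, v₂} := by
    refine (Set.eq_of_subset_of_ncard_le ?_ ?_).symm
    · exact Set.insert_subset hw hpair
    · rwa [Set.ncard_insert_of_notMem hw', Set.ncard_pair hne]
  have hwX : w ∈ X := by
    by_contra hwX
    exact hw' (hX u hu w hwX hw).2
  refine hG.not_bridge (X := X \ {u}) (u := w) (v := u) ⟨hwX, hw.ne'⟩ (fun h ↦ h.2 rfl) hw.symm ?_
  rintro a ⟨ha, hau⟩ b hb hab
  by_cases hbu : b = u
  · subst hbu
    have : a ∈ G.neighborSet b := hab.symm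
    rw [hN] at this
    rcases this with rfl | rfl | rfl
    exacts [⟨rfl, rfl⟩, absurd ha hv₁, absurd ha hv₂]
  · exact absurd (hX a ha b (fun hbX ↦ hb ⟨hbX, hbu⟩) hab).1 hau

/-- A connected graph that becomes disconnected by deleting the edges in `s` has a vertex set
that is left by an edge and only by edges in `s`. -/
theorem exists_cut {V : Type} {G : SimpleGraph V} {s : Set (Sym2 V)}
    (hconn : G.Connected) (hcut : ¬ (G.deleteEdges s).Connected) :
    ∃ X : Set V, (∀ a ∈ X, ∀ b ∉ X, G.Adj a b → s(a, b) ∈ s) ∧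
      ∃ a ∈ X, ∃ b ∉ X, G.Adj a b := by
  have := hconn.nonempty
  obtain ⟨p, q, hpq⟩ : ∃ p q, ¬ (G.deleteEdges s).Reachable p q := by
    by_contra! h
    exact hcut ⟨h⟩
  refine ⟨{x | (G.deleteEdges s).Reachable p x}, fun a ha b hb hab ↦ ?_, ?_⟩
  · by_contra hs
    exact hb (Reachable.trans ha (Adj.reachable ((deleteEdges_adj).2 ⟨hab, hs⟩)))
  · obtain ⟨w⟩ := hconn p q
    obtain ⟨d, -, hd, hd'⟩ := w.exists_boundary_dart
      {x | (G.deleteEdges s).Reachable p x} (Reachable.refl p) hpq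
    exact ⟨d.fst, hd, d.snd, hd', d.adj⟩

/-- In a minimal counterexample, any edge-cut of size two consists of two edges sharing a
common endpoint of degree 2. -/
theorem minCounter_two_edge_cut {V : Type} [Finite V] (G : SimpleGraph V)
    (hG : MinCounter V G)
    (e₁ e₂ : Sym2 V) (he₁ : e₁ ∈ G.edgeSet) (he₂ : e₂ ∈ G.edgeSet) (hne : e₁ ≠ e₂)
    (hconn : G.Connected) (hcut : ¬(G.deleteEdges {e₁, e₂}).Connected) :
    ∃ v : V, v ∈ e₁ ∧ v ∈ e₂ ∧ (G.neighborSet v).ncard = 2 := by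
  obtain ⟨X, hX, a, ha, b, hb, hab⟩ := exists_cut hconn hcut
  wlog hs : s(a, b) = e₁ generalizing e₁ e₂
  · obtain ⟨v, h1, h2, h3⟩ := this e₂ e₁ he₂ he₁ hne.symm (by rwa [Set.pair_comm])
      (by rwa [Set.pair_comm]) ((hX a ha b hb hab).resolve_left hs)
    exact ⟨v, h2, h1, h3⟩
  subst hs
  by_cases h : ∃ x ∈ X, ∃ y ∉ X, s(x, y) = e₂
  · obtain ⟨x, hx, y, hy, rfl⟩ := h
    have ne : ∀ {a b}, a ∈ X → b ∉ X → a ≠ b := fun ha hb h ↦ hb (h ▸ ha)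
    have hX' : ∀ u ∈ X, ∀ v ∉ X, G.Adj u v → (u = a ∧ v = b) ∨ (u = x ∧ v = y) := by
      intro u hu v hv huv
      refine (hX u hu v hv huv).imp (fun h ↦ ?_) (fun h ↦ ?_)
      · exact (Sym2.eq_iff.1 h).resolve_right fun h ↦ ne hu hb h.1
      · exact (Sym2.eq_iff.1 h).resolve_right fun h ↦ ne hu hy h.1
    by_cases hax : a = x
    · subst hax
      refine ⟨a, by simp, by simp, hG.ncard_neighborSet_eq_two ha hb hy hab he₂
        (by rintro rfl; exact hne rfl) fun u hu v hv huv ↦ ?_⟩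
      have := hX' u hu v hv huv
      tauto
    · by_cases hby : b = y
      · subst hby
        refine ⟨b, by simp, by simp, hG.ncard_neighborSet_eq_two (X := Xᶜ) hb (not_not.2 ha)
          (not_not.2 hx) hab.symm (G.adj_symm he₂) hax fun u hu v hv huv ↦ ?_⟩
        have := hX' v (not_not.1 hv) u hu huv.symm
        tauto
      · exact (hG.not_matchingCut ⟨ha, hx, hb, hy, hab, he₂, hax, hby, hX'⟩).elim
  · refine (hG.not_bridge ha hb hab fun u hu v hv huv ↦ ?_).elim
    have h1 := (hX u hu v hv huv).resolve_right fun h' ↦ h ⟨u, hu, v, hv, h'⟩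
    exact (Sym2.eq_iff.1 h1).resolve_right fun h ↦ hb (h.1 ▸ hu)
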